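/- (Divergence of the Helmholtz seed fields χ_a.) Let k > 0 be real and let a be an integer. On the open set U = {(x,y) ∈ ℝ² : ρ > 0}, the complex vector field χ_a(x,y) = r^{a} e^{ikr} / (4π ρ²) · (x−x_p, y−y_p) is differentiable and satisfies ∇_s·χ_a(x,y) = ( a·r^{a-2} + i k·r^{a-1} ) · e^{ikr} / (4π) for all (x,y) ∈ U. In particular ∇_s·( χ_0 / (ik) ) = r^{-1} e^{ikr}/(4π), so m_{0,0,0} = χ_0/(ik) satisfies the defining relation (4.34) for the index (0,0,0). -/

import Mathlib

/-- Surface divergence of a planar complex vector field: ∂_x m₁ + ∂_y m₂. -/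
noncomputable def sdivC (m : ℝ × ℝ → ℂ × ℂ) (p : ℝ × ℝ) : ℂ :=
  (fderiv ℝ m p (1, 0)).1 + (fderiv ℝ m p (0, 1)).2

/-- A planar field `G(ρ²) • (x - x₀, y - y₀)` has divergence `2 (G(ρ²) + ρ² G'(ρ²))`. -/
theorem differentiableAt_and_sdivC_radial (x₀ y₀ : ℝ) {G : ℝ → ℂ} {G' : ℂ} {p : ℝ × ℝ}
    (hG : HasDerivAt G G' ((p.1 - x₀) ^ 2 + (p.2 - y₀) ^ 2)) :
    DifferentiableAt ℝ (fun q : ℝ × ℝ => G ((q.1 - x₀) ^ 2 + (q.2 - y₀) ^ 2) •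
      (((q.1 - x₀ : ℝ) : ℂ), ((q.2 - y₀ : ℝ) : ℂ))) p ∧
    sdivC (fun q : ℝ × ℝ => G ((q.1 - x₀) ^ 2 + (q.2 - y₀) ^ 2) •
      (((q.1 - x₀ : ℝ) : ℂ), ((q.2 - y₀ : ℝ) : ℂ))) p =
      2 * (G ((p.1 - x₀) ^ 2 + (p.2 - y₀) ^ 2) +
        (((p.1 - x₀) ^ 2 + (p.2 - y₀) ^ 2 : ℝ) : ℂ) * G') := by
  have hx : HasFDerivAt (fun q : ℝ × ℝ => q.1 - x₀) (ContinuousLinearMap.fst ℝ ℝ ℝ) p :=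
    hasFDerivAt_fst.sub_const x₀
  have hy : HasFDerivAt (fun q : ℝ × ℝ => q.2 - y₀) (ContinuousLinearMap.snd ℝ ℝ ℝ) p :=
    hasFDerivAt_snd.sub_const y₀
  have hφ := hG.hasFDerivAt.comp p ((hx.pow 2).add (hy.pow 2))
  have hx' := Complex.ofRealCLM.hasFDerivAt.comp p hx
  have hy' := Complex.ofRealCLM.hasFDerivAt.comp p hy
  have hV := (hφ.mul hx').prodMk (hφ.mul hy')
  refine ⟨hV.differentiableAt, ?_⟩
  have hfd := hV.fderiv
  unfold sdivC
  erw [hfd]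
  simp
  ring

/-- The derivative of `u ↦ g (√(u + h²)) / u`. -/
theorem hasDerivAt_comp_sqrt_div {h u : ℝ} (hu : 0 < u) {g : ℝ → ℂ} {g' : ℂ}
    (hg : HasDerivAt g g' (Real.sqrt (u + h ^ 2))) :
    HasDerivAt (fun v : ℝ => g (Real.sqrt (v + h ^ 2)) / (v : ℂ))
      (g' / (2 * (Real.sqrt (u + h ^ 2) : ℂ) * u) - g (Real.sqrt (u + h ^ 2)) / (u : ℂ) ^ 2) u := by
  have hpos : 0 < u + h ^ 2 := by positivity
  have hs : HasDerivAt (fun v : ℝ => Real.sqrt (v + h ^ 2))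
      (1 / (2 * Real.sqrt (u + h ^ 2))) u :=
    ((hasDerivAt_id u).add_const (h ^ 2)).sqrt hpos.ne'
  have hu' : (u : ℂ) ≠ 0 := by exact_mod_cast hu.ne'
  have hr' : (Real.sqrt (u + h ^ 2) : ℂ) ≠ 0 := by exact_mod_cast (Real.sqrt_pos.2 hpos).ne'
  have hd := (hg.scomp u hs).div (HasDerivAt.ofReal_comp (hasDerivAt_id u)) hu'
  refine hd.congr_deriv ?_
  simp only [Function.comp_apply, id_eq, Complex.real_smul]
  push_cast
  field_simp

/-- The derivative of `t ↦ t ^ a * exp (i k t) / (4 π)` for an integer exponent `a`. -/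
theorem hasDerivAt_zpow_mul_exp (k : ℝ) (a : ℤ) {t : ℝ} (ht : t ≠ 0) :
    HasDerivAt (fun s : ℝ => (s : ℂ) ^ a * Complex.exp (Complex.I * (k : ℂ) * (s : ℂ)) /
        (4 * (Real.pi : ℂ)))
      (((a : ℂ) * (t : ℂ) ^ (a - 1) + Complex.I * (k : ℂ) * (t : ℂ) ^ a) *
        Complex.exp (Complex.I * (k : ℂ) * (t : ℂ)) / (4 * (Real.pi : ℂ))) t := by
  have ht' : (t : ℂ) ≠ 0 := by exact_mod_cast ht
  have hz := hasDerivAt_zpow a (t : ℂ) (Or.inl ht')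
  have he := ((hasDerivAt_id (t : ℂ)).const_mul (Complex.I * (k : ℂ))).cexp
  refine (((hz.mul he).div_const (4 * (Real.pi : ℂ))).comp_ofReal).congr_deriv ?_
  simp only [id_eq]
  ring

/-- Divergence of `r ^ a * exp (i k r) / (4 π ρ²) • (x - x₀, y - y₀)`. -/
theorem differentiableAt_and_sdivC_seed (x₀ y₀ h k : ℝ) (a : ℤ) (r ρ : ℝ × ℝ → ℝ)
    (hr : ∀ p : ℝ × ℝ, r p = Real.sqrt ((p.1 - x₀) ^ 2 + (p.2 - y₀) ^ 2 + h ^ 2))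
    (hρ : ∀ p : ℝ × ℝ, ρ p = Real.sqrt ((p.1 - x₀) ^ 2 + (p.2 - y₀) ^ 2))
    (f : ℝ × ℝ → ℂ × ℂ)
    (hf : ∀ p : ℝ × ℝ, f p =
      ((r p : ℂ) ^ a * Complex.exp (Complex.I * (k : ℂ) * (r p : ℂ)) /
        (4 * (Real.pi : ℂ) * (ρ p : ℂ) ^ 2)) • (((p.1 - x₀ : ℝ) : ℂ), ((p.2 - y₀ : ℝ) : ℂ)))
    {p : ℝ × ℝ} (hp : 0 < ρ p) :
    DifferentiableAt ℝ f p ∧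
      sdivC f p = ((a : ℂ) * (r p : ℂ) ^ (a - 2) + Complex.I * (k : ℂ) * (r p : ℂ) ^ (a - 1)) *
        Complex.exp (Complex.I * (k : ℂ) * (r p : ℂ)) / (4 * (Real.pi : ℂ)) := by
  have hu : 0 < (p.1 - x₀) ^ 2 + (p.2 - y₀) ^ 2 := by
    rw [hρ] at hp
    exact Real.sqrt_pos.1 hp
  have hrpos : 0 < Real.sqrt ((p.1 - x₀) ^ 2 + (p.2 - y₀) ^ 2 + h ^ 2) :=
    Real.sqrt_pos.2 (by positivity)
  have hfun : f = fun q : ℝ × ℝ =>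
      (fun v : ℝ => (fun s : ℝ => (s : ℂ) ^ a * Complex.exp (Complex.I * (k : ℂ) * (s : ℂ)) /
        (4 * (Real.pi : ℂ))) (Real.sqrt (v + h ^ 2)) / (v : ℂ))
        ((q.1 - x₀) ^ 2 + (q.2 - y₀) ^ 2) •
      (((q.1 - x₀ : ℝ) : ℂ), ((q.2 - y₀ : ℝ) : ℂ)) := by
    funext q
    have hsq : (ρ q : ℂ) ^ 2 = (((q.1 - x₀) ^ 2 + (q.2 - y₀) ^ 2 : ℝ) : ℂ) := by
      rw [← Complex.ofReal_pow, hρ, Real.sq_sqrt (by positivity)]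
    rw [hf, hsq, hr, div_mul_eq_div_div]
  obtain ⟨hd, hs⟩ := differentiableAt_and_sdivC_radial x₀ y₀
    (hasDerivAt_comp_sqrt_div (h := h) hu (hasDerivAt_zpow_mul_exp k a hrpos.ne'))
  rw [← hfun] at hd hs
  refine ⟨hd, hs.trans ?_⟩
  rw [← hr] at hrpos ⊢
  have hu' : (((p.1 - x₀) ^ 2 + (p.2 - y₀) ^ 2 : ℝ) : ℂ) ≠ 0 := by exact_mod_cast hu.ne'
  have hr' : (r p : ℂ) ≠ 0 := by exact_mod_cast hrpos.ne'
  have hπ : (Real.pi : ℂ) ≠ 0 := by exact_mod_cast Real.pi_ne_zero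
  generalize (((p.1 - x₀) ^ 2 + (p.2 - y₀) ^ 2 : ℝ) : ℂ) = u at hu' ⊢
  rw [show a - 2 = a - 1 - 1 by ring, zpow_sub_one₀ hr' (a - 1), zpow_sub_one₀ hr' a]
  field_simp
  ring

/-- The surface divergence commutes with multiplication by a complex constant. -/
theorem sdivC_const_smul (c : ℂ) {m : ℝ × ℝ → ℂ × ℂ} {p : ℝ × ℝ}
    (hm : DifferentiableAt ℝ m p) : sdivC (fun q => c • m q) p = c * sdivC m p := by
  unfold sdivC
  rw [fderiv_fun_const_smul hm c]
  simp [mul_add]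

/-- Divergence of the Helmholtz seed fields χ_a, and the seed property of
m_{0,0,0} = χ_0/(ik) for the defining relation (4.34). -/
theorem stmt5 (xp yp h k : ℝ) (hk : 0 < k) (a : ℤ)
    (r ρ : ℝ × ℝ → ℝ)
    (hr : ∀ p : ℝ × ℝ, r p = Real.sqrt ((p.1 - xp) ^ 2 + (p.2 - yp) ^ 2 + h ^ 2))
    (hρ : ∀ p : ℝ × ℝ, ρ p = Real.sqrt ((p.1 - xp) ^ 2 + (p.2 - yp) ^ 2))
    (χ : ℤ → (ℝ × ℝ → ℂ × ℂ))
    (hχ : ∀ (a' : ℤ) (p : ℝ × ℝ), χ a' p =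
      ((r p : ℂ) ^ a' * Complex.exp (Complex.I * (k : ℂ) * (r p : ℂ)) /
        (4 * (Real.pi : ℂ) * (ρ p : ℂ) ^ 2)) • (((p.1 - xp : ℝ) : ℂ), ((p.2 - yp : ℝ) : ℂ))) :
    ∀ p ∈ {p : ℝ × ℝ | 0 < ρ p},
      (DifferentiableAt ℝ (χ a) p ∧
        sdivC (χ a) p = ((a : ℂ) * (r p : ℂ) ^ (a - 2) + Complex.I * (k : ℂ) * (r p : ℂ) ^ (a - 1)) *
          Complex.exp (Complex.I * (k : ℂ) * (r p : ℂ)) / (4 * (Real.pi : ℂ))) ∧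
      sdivC (fun q => (Complex.I * (k : ℂ))⁻¹ • χ 0 q) p =
        (r p : ℂ) ^ (-1 : ℤ) * Complex.exp (Complex.I * (k : ℂ) * (r p : ℂ)) / (4 * (Real.pi : ℂ)) := by
  intro p hp
  refine ⟨differentiableAt_and_sdivC_seed xp yp h k a r ρ hr hρ (χ a) (hχ a) hp, ?_⟩
  obtain ⟨hd, hs⟩ := differentiableAt_and_sdivC_seed xp yp h k 0 r ρ hr hρ (χ 0) (hχ 0) hp
  have hk' : (k : ℂ) ≠ 0 := by exact_mod_cast hk.ne'
  rw [sdivC_const_smul _ hd, hs, Int.cast_zero, zero_mul, zero_add, zero_sub]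
  field_simp [Complex.I_ne_zero]
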